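/- arXiv:2310.18739 — 2 statements merged into one kernel-verified Lean document; each statement's English description precedes it below -/
import Mathlib

section
/- Fix ε ∈ ℝ. The vector fields ξ₁, ξ₂, ξ₃, ξ₄ of the ε-family on ℝ⁷ satisfy, as equalities of maps ℝ⁷ → ℝ⁷: [ξ₁,ξ₂] = 0, [ξ₃,ξ₄] = 0, [ξ₁,ξ₃] = ξ₅, [ξ₁,ξ₄] = ξ₆, [ξ₂,ξ₃] = ξ₆, [ξ₂,ξ₄] = ξ₇. In particular [ξ₁,ξ₂] = 0, [ξ₃,ξ₄] = 0 and [ξ₁,ξ₄] = [ξ₂,ξ₃], so (ξ₁,ξ₂,ξ₃,ξ₄) is an adapted frame of a hyperbolic (4,7)-distribution for every ε. -/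
/- The ε-family of hyperbolic (4,7)-distributions on ℝ⁷ with coordinates
(x, y, s, t, z, w, u), indexed by 0,…,6. Vector fields are identified with
maps ℝ⁷ → ℝ⁷ of their coefficients in the coordinate frame. -/

def xi1 (ε : ℝ) (q : Fin 7 → ℝ) : Fin 7 → ℝ := ![1, 0, q 5 + ε * q 3, q 1, 0, 0, 0]
def xi2 (q : Fin 7 → ℝ) : Fin 7 → ℝ := ![0, 0, 0, 0, 1, 0, q 5]
def xi3 (ε : ℝ) (q : Fin 7 → ℝ) : Fin 7 → ℝ := ![0, 1, -(q 4 - ε * q 3), -q 0, 0, 0, 0]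
def xi4 (q : Fin 7 → ℝ) : Fin 7 → ℝ := ![0, 0, 0, 0, 0, 1, -q 4]
def xi5 (ε : ℝ) (q : Fin 7 → ℝ) : Fin 7 → ℝ := ![0, 0, ε * (q 0 + q 1), -2, 0, 0, 0]
def xi6 (_ : Fin 7 → ℝ) : Fin 7 → ℝ := ![0, 0, -1, 0, 0, 0, 0]
def xi7 (_ : Fin 7 → ℝ) : Fin 7 → ℝ := ![0, 0, 0, 0, 0, 0, -2]

/-- A map from a finite-dimensional space whose difference `f q - f 0` is linear in `q` has this
linear map as its derivative everywhere. -/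
theorem fderiv_apply_eq_sub_of_isLinearMap {E F : Type*} [NormedAddCommGroup E] [NormedSpace ℝ E]
    [FiniteDimensional ℝ E] [NormedAddCommGroup F] [NormedSpace ℝ F] {f : E → F}
    (hf : IsLinearMap ℝ fun q => f q - f 0) (p v : E) :
    fderiv ℝ f p v = f v - f 0 := by
  let L : E →L[ℝ] F := LinearMap.toContinuousLinearMap hf.mk'
  have hL (q : E) : L q + f 0 = f q := by simp [L]
  have hd : HasFDerivAt f L p := by
    simpa only [hL] using L.hasFDerivAt.add_const (f 0)
  rw [hd.fderiv]
  exact eq_sub_of_add_eq (hL v)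

theorem lieBracket_apply_of_isLinearMap {E : Type*} [NormedAddCommGroup E] [NormedSpace ℝ E]
    [FiniteDimensional ℝ E] {V W : E → E} (hV : IsLinearMap ℝ fun q => V q - V 0)
    (hW : IsLinearMap ℝ fun q => W q - W 0) (p : E) :
    VectorField.lieBracket ℝ V W p = (W (V p) - W 0) - (V (W p) - V 0) := by
  rw [VectorField.lieBracket, fderiv_apply_eq_sub_of_isLinearMap hW,
    fderiv_apply_eq_sub_of_isLinearMap hV]

theorem isLinearMap_xi1_sub (ε : ℝ) : IsLinearMap ℝ fun q => xi1 ε q - xi1 ε 0 := by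
  constructor <;> intros <;> ext i <;> fin_cases i <;> simp [xi1] <;> ring

theorem isLinearMap_xi2_sub : IsLinearMap ℝ fun q => xi2 q - xi2 0 := by
  constructor <;> intros <;> ext i <;> fin_cases i <;> simp [xi2]

theorem isLinearMap_xi3_sub (ε : ℝ) : IsLinearMap ℝ fun q => xi3 ε q - xi3 ε 0 := by
  constructor <;> intros <;> ext i <;> fin_cases i <;> simp [xi3] <;> ring

theorem isLinearMap_xi4_sub : IsLinearMap ℝ fun q => xi4 q - xi4 0 := by
  constructor <;> intros <;> ext i <;> fin_cases i <;> simp [xi4]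
  ring

/-- For every ε, the frame (ξ₁,ξ₂,ξ₃,ξ₄) of the ε-family satisfies
[ξ₁,ξ₂] = 0, [ξ₃,ξ₄] = 0, [ξ₁,ξ₃] = ξ₅, [ξ₁,ξ₄] = ξ₆, [ξ₂,ξ₃] = ξ₆,
[ξ₂,ξ₄] = ξ₇; in particular [ξ₁,ξ₄] = [ξ₂,ξ₃], so it is an adapted frame of a
hyperbolic (4,7)-distribution. -/
theorem epsilon_family_brackets (ε : ℝ) :
    VectorField.lieBracket ℝ (xi1 ε) xi2 = (fun _ => (0 : Fin 7 → ℝ)) ∧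
    VectorField.lieBracket ℝ (xi3 ε) xi4 = (fun _ => (0 : Fin 7 → ℝ)) ∧
    VectorField.lieBracket ℝ (xi1 ε) (xi3 ε) = xi5 ε ∧
    VectorField.lieBracket ℝ (xi1 ε) xi4 = xi6 ∧
    VectorField.lieBracket ℝ xi2 (xi3 ε) = xi6 ∧
    VectorField.lieBracket ℝ xi2 xi4 = xi7 ∧
    VectorField.lieBracket ℝ (xi1 ε) xi4 = VectorField.lieBracket ℝ xi2 (xi3 ε) := by
  have h₁ := isLinearMap_xi1_sub ε
  have h₂ := isLinearMap_xi2_sub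
  have h₃ := isLinearMap_xi3_sub ε
  have h₄ := isLinearMap_xi4_sub
  have h₁₄ : VectorField.lieBracket ℝ (xi1 ε) xi4 = xi6 := by
    ext p i
    rw [lieBracket_apply_of_isLinearMap h₁ h₄]
    fin_cases i <;> simp [xi1, xi4, xi6]
  have h₂₃ : VectorField.lieBracket ℝ xi2 (xi3 ε) = xi6 := by
    ext p i
    rw [lieBracket_apply_of_isLinearMap h₂ h₃]
    fin_cases i <;> simp [xi2, xi3, xi6]
  refine ⟨?_, ?_, ?_, h₁₄, h₂₃, ?_, h₁₄.trans h₂₃.symm⟩ <;> ext p i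
  · rw [lieBracket_apply_of_isLinearMap h₁ h₂]
    fin_cases i <;> simp [xi1, xi2]
  · rw [lieBracket_apply_of_isLinearMap h₃ h₄]
    fin_cases i <;> simp [xi3, xi4]
  · rw [lieBracket_apply_of_isLinearMap h₁ h₃]
    fin_cases i <;> simp [xi1, xi3, xi5] <;> ring
  · rw [lieBracket_apply_of_isLinearMap h₂ h₄]
    fin_cases i <;> simp [xi2, xi4, xi7]
    ring
end

section
/- Fix ε ∈ ℝ. At every point p ∈ ℝ⁷, the seven vectors ξ₁(p), ξ₂(p), ξ₃(p), ξ₄(p), ξ₅(p), ξ₆(p), ξ₇(p) of the ε-family form a basis of ℝ⁷. (Hence the distribution D spanned by ξ₁,…,ξ₄ is a (4,7)-distribution: D together with the brackets ξ₅ = [ξ₁,ξ₃], ξ₆ = [ξ₁,ξ₄], ξ₇ = [ξ₂,ξ₄] spans the whole tangent space at each point.) -/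
/-- For every ε and every point p ∈ ℝ⁷, the seven vectors ξ₁(p),…,ξ₇(p) of
the ε-family form a basis of ℝ⁷; hence span{ξ₁,…,ξ₄} is a
(4,7)-distribution. -/
theorem epsilon_family_frame (ε : ℝ) (p : Fin 7 → ℝ) :
    LinearIndependent ℝ
        ![xi1 ε p, xi2 p, xi3 ε p, xi4 p, xi5 ε p, xi6 p, xi7 p] ∧
      Submodule.span ℝ
        (Set.range ![xi1 ε p, xi2 p, xi3 ε p, xi4 p, xi5 ε p, xi6 p, xi7 p]) = ⊤ := by
  have hli : LinearIndependent ℝ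
      ![xi1 ε p, xi2 p, xi3 ε p, xi4 p, xi5 ε p, xi6 p, xi7 p] := by
    rw [Fintype.linearIndependent_iff]
    intro g hg
    have h := fun j => congrFun hg j
    simp only [Fin.forall_fin_succ, Fin.sum_univ_succ, xi1, xi2, xi3, xi4, xi5, xi6, xi7] at h
    simp at h
    obtain ⟨hx, hy, hs, ht, hz, hw, hu⟩ := h
    simp [hx, hy, hz, hw] at hs ht hu
    simp [ht] at hs
    intro i
    fin_cases i <;> simp_all
  refine ⟨hli, hli.span_eq_top_of_card_eq_finrank ?_⟩
  simp
end
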